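/- For all positive integers n, p, k with p ≤ n, the second generalized q-binomial coefficient [n choose p,k]_q, defined by [n choose p,k]_q = ([n]_q/[k]_q) · Σ_{r≥0} [p choose r]_q [n-p choose r]_q [n-r-1 choose k-r-1]_q q^{r²}, is a polynomial in q with nonnegative integer coefficients, and satisfies the symmetry [n choose p,k]_q = [n choose n-p,k]_q and the boundary value [n choose p,n]_q = [n choose p]_q. -/

import Mathlib

open Finset

/-- The variable `q`, as a rational function over `ℚ`. -/
noncomputable def q : RatFunc ℚ := RatFunc.X

/-- The q-integer `[m]_q = (1 - q^m)/(1 - q)`. -/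
noncomputable def qint (m : ℕ) : RatFunc ℚ := (1 - q ^ m) / (1 - q)

/-- The q-integer for an integer exponent, `[x; q] = (q^x - 1)/(q - 1)`. -/
noncomputable def qintZ (x : ℤ) : RatFunc ℚ := (q ^ x - 1) / (q - 1)

/-- The q-factorial `[m]!_q`. -/
noncomputable def qfac (m : ℕ) : RatFunc ℚ := ∏ i ∈ Finset.range m, qint (i + 1)

/-- The Gaussian q-binomial coefficient `[a choose b]_q`, zero when `b < 0` or `b > a`. -/
noncomputable def qbin (a b : ℤ) : RatFunc ℚ :=
  if 0 ≤ b ∧ b ≤ a then qfac a.toNat / (qfac b.toNat * qfac (a - b).toNat) else 0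

/-- The first generalized q-binomial coefficient `(n choose p, k)_q`:
`([n]_q/[k]_q) · Σ_{r≥0} [p choose r]_q [n-p choose r]_q [n-r-1 choose k-r-1]_q
  q^{(n-p)p + r(r-k)}`. -/
noncomputable def gchoose (n p k : ℕ) : RatFunc ℚ :=
  (qint n / qint k) *
    ∑ r ∈ Finset.range (n + 1),
      qbin p r * qbin ((n : ℤ) - p) r * qbin ((n : ℤ) - r - 1) ((k : ℤ) - r - 1) *
        q ^ (((n : ℤ) - p) * p + (r : ℤ) * ((r : ℤ) - k))

/-- The second generalized q-binomial coefficient `[n choose p, k]_q`. -/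
noncomputable def gbin2 (n p k : ℕ) : RatFunc ℚ :=
  (qint n / qint k) *
    ∑ r ∈ Finset.range (n + 1),
      qbin p r * qbin ((n : ℤ) - p) r * qbin ((n : ℤ) - r - 1) ((k : ℤ) - r - 1) *
        q ^ (r ^ 2)


lemma q_pow_ne (m : ℕ) : (1 : RatFunc ℚ) - q ^ (m + 1) ≠ 0 := by
  intro h
  have h1 : (q : RatFunc ℚ) ^ (m + 1) = 1 := (sub_eq_zero.mp h).symm
  have h2 : algebraMap (Polynomial ℚ) (RatFunc ℚ) (Polynomial.X ^ (m + 1)) =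
      algebraMap (Polynomial ℚ) (RatFunc ℚ) 1 := by
    rw [map_pow, map_one, RatFunc.algebraMap_X]; exact h1
  have h3 := RatFunc.algebraMap_injective ℚ h2
  have h4 := congrArg Polynomial.natDegree h3
  simp at h4

lemma one_sub_q_ne : (1 : RatFunc ℚ) - q ≠ 0 := by simpa using q_pow_ne 0

lemma qint_succ_ne (m : ℕ) : qint (m + 1) ≠ 0 :=
  div_ne_zero (q_pow_ne m) one_sub_q_ne

lemma qint_zero : qint 0 = 0 := by simp [qint]

lemma qint_one : qint 1 = 1 := by
  have := one_sub_q_ne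
  simp [qint, this]

lemma qint_add (a b : ℕ) : qint (a + b) = qint a + q ^ a * qint b := by
  have := one_sub_q_ne
  unfold qint
  field_simp
  ring

lemma qfac_succ (m : ℕ) : qfac (m + 1) = qfac m * qint (m + 1) := by
  simp [qfac, Finset.prod_range_succ]

lemma qfac_ne (m : ℕ) : qfac m ≠ 0 :=
  Finset.prod_ne_zero_iff.mpr fun i _ => qint_succ_ne i

/-- Gaussian binomials by Pascal recursion. -/
noncomputable def gb : ℕ → ℕ → RatFunc ℚ
  | _, 0 => 1
  | 0, _ + 1 => 0
  | a + 1, b + 1 => gb a b + q ^ (b + 1) * gb a (b + 1)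

lemma gb_zero_right (a : ℕ) : gb a 0 = 1 := by cases a <;> simp [gb]

lemma gb_succ (a b : ℕ) : gb (a + 1) (b + 1) = gb a b + q ^ (b + 1) * gb a (b + 1) := by
  simp [gb]

lemma gb_lt : ∀ a b : ℕ, a < b → gb a b = 0
  | _, 0, h => by omega
  | 0, b + 1, _ => by simp [gb]
  | a + 1, b + 1, h => by
    rw [gb_succ, gb_lt a b (by omega), gb_lt a (b + 1) (by omega)]; simp

lemma gb_self : ∀ a : ℕ, gb a a = 1
  | 0 => by simp [gb]
  | a + 1 => by rw [gb_succ, gb_self a, gb_lt a (a + 1) (by omega)]; simp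

lemma gb_fac : ∀ b c : ℕ, gb (b + c) b * (qfac b * qfac c) = qfac (b + c)
  | 0, c => by simp [gb_zero_right, qfac]
  | b + 1, 0 => by simp [gb_self, qfac]
  | b + 1, c + 1 => by
    have h1 := gb_fac b (c + 1)
    have h2 := gb_fac (b + 1) c
    have e : b + 1 + (c + 1) = (b + c + 1) + 1 := by omega
    rw [e, gb_succ, qfac_succ (b + c + 1)]
    have e1 : b + (c + 1) = b + c + 1 := by omega
    have e2 : b + 1 + c = b + c + 1 := by omega
    rw [e1] at h1
    rw [e2] at h2
    have e3 : b + c + 1 + 1 = (b + 1) + (c + 1) := by omega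
    rw [e3, qint_add (b + 1) (c + 1)]
    rw [qfac_succ b] at h2 ⊢
    rw [qfac_succ c] at h1 ⊢
    linear_combination qint (b + 1) * h1 + q ^ (b + 1) * qint (c + 1) * h2

lemma gb_eq (b c : ℕ) : gb (b + c) b = qfac (b + c) / (qfac b * qfac c) := by
  rw [eq_div_iff (mul_ne_zero (qfac_ne b) (qfac_ne c)), gb_fac]

lemma qbin_eq (a b : ℕ) : qbin (a : ℤ) (b : ℤ) = gb a b := by
  unfold qbin
  split_ifs with h
  · obtain ⟨c, rfl⟩ := Nat.exists_eq_add_of_le (show b ≤ a by omega)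
    rw [gb_eq]
    congr 2
    congr 1
    omega
  · rw [gb_lt]; omega

lemma gb_symm (b c : ℕ) : gb (b + c) b = gb (b + c) c := by
  rw [gb_eq, add_comm b c, gb_eq, mul_comm]

/-- absorption -/
lemma gb_absorb (a b : ℕ) : qint (b + 1) * gb (a + 1) (b + 1) = qint (a + 1) * gb a b := by
  rcases Nat.lt_or_ge a b with h | h
  · rw [gb_lt a b h, gb_lt (a + 1) (b + 1) (by omega)]; simp
  · obtain ⟨c, rfl⟩ := Nat.exists_eq_add_of_le h
    have e : b + c + 1 = (b + 1) + c := by omega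
    have h1 := gb_fac b c
    have h2 := gb_fac (b + 1) c
    rw [← e, qfac_succ b, qfac_succ (b + c)] at h2
    apply mul_right_cancel₀ (mul_ne_zero (qfac_ne b) (qfac_ne c))
    linear_combination h2 - qint (b + c + 1) * h1

lemma gb_step (b c : ℕ) : qint (b + 1) * gb (b + c) (b + 1) = qint c * gb (b + c) b := by
  have h1 := gb_absorb (b + c) b
  rw [gb_succ] at h1
  have h2 : qint (b + c + 1) = qint (b + 1) + q ^ (b + 1) * qint c := by
    rw [← qint_add]; congr 1; omega
  rw [h2] at h1
  have hq : (q : RatFunc ℚ) ^ (b + 1) ≠ 0 := pow_ne_zero _ RatFunc.X_ne_zero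
  apply mul_left_cancel₀ hq
  linear_combination h1

lemma gb_succ' (b c : ℕ) : gb (b + c + 1) (b + 1) = q ^ c * gb (b + c) b + gb (b + c) (b + 1) := by
  have h1 := gb_absorb (b + c) b
  have h2 := gb_step b c
  have h3 : qint (b + c + 1) = qint c + q ^ c * qint (b + 1) := by
    rw [← qint_add]; congr 1; omega
  rw [h3] at h1
  apply mul_left_cancel₀ (qint_succ_ne b)
  linear_combination h1 - h2

lemma vandermonde (p : ℕ) : ∀ m d : ℕ,
    ∑ r ∈ Finset.range (p + 1), gb p r * gb m (r + d) * q ^ (r * (r + d)) = gb (p + m) (p + d) := by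
  induction p with
  | zero => intro m d; simp [gb_zero_right]
  | succ p ih =>
    intro m d
    have e1 : p + 1 + m = (p + m) + 1 := by omega
    have e2 : p + 1 + d = (p + d) + 1 := by omega
    rw [e1, e2, gb_succ, ← ih m d]
    have e3 : p + d + 1 = p + (d + 1) := by omega
    rw [e3, ← ih m (d + 1), Finset.sum_range_succ', Finset.mul_sum]
    have h : ∑ r ∈ Finset.range (p + 1), gb p r * gb m (r + d) * q ^ (r * (r + d))
        = ∑ r ∈ Finset.range (p + 1),
            gb p (r + 1) * gb m (r + 1 + d) * q ^ ((r + 1) * (r + 1 + d))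
          + gb p 0 * gb m (0 + d) * q ^ (0 * (0 + d)) := by
      rw [← Finset.sum_range_succ' (fun r => gb p r * gb m (r + d) * q ^ (r * (r + d))),
        Finset.sum_range_succ _ (p + 1), gb_lt p (p + 1) (by omega)]
      simp
    rw [h, gb_zero_right, gb_zero_right, add_right_comm, ← Finset.sum_add_distrib]
    congr 1
    apply Finset.sum_congr rfl
    intro r hr
    obtain ⟨c, rfl⟩ := Nat.exists_eq_add_of_le (show r ≤ p by simp at hr; omega)
    rw [gb_succ']
    have e4 : r + 1 + d = r + (d + 1) := by omega
    rw [e4]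
    ring

/-- The semiring of rational functions that are polynomials with natural coefficients. -/
noncomputable def natHom : Polynomial ℕ →+* RatFunc ℚ :=
  (algebraMap (Polynomial ℚ) (RatFunc ℚ)).comp (Polynomial.mapRingHom (Nat.castRingHom ℚ))

lemma q_mem : q ∈ natHom.rangeS := ⟨Polynomial.X, by simp [natHom, q]⟩

lemma gb_mem : ∀ a b : ℕ, gb a b ∈ natHom.rangeS
  | a, 0 => by rw [gb_zero_right]; exact one_mem _
  | 0, b + 1 => by simp [gb]
  | a + 1, b + 1 => by
    rw [gb_succ]
    exact add_mem (gb_mem _ _) (mul_mem (pow_mem q_mem _) (gb_mem _ _))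

/-- The last factor of the summand. -/
noncomputable def Bf (n k r : ℕ) : RatFunc ℚ :=
  if r < k then gb (n - r - 1) (k - r - 1) else 0

lemma Bf_eq (n k r : ℕ) (hkn : k ≤ n) :
    qbin ((n : ℤ) - r - 1) ((k : ℤ) - r - 1) = Bf n k r := by
  unfold Bf
  split_ifs with h
  · rw [← qbin_eq]; congr 1 <;> omega
  · unfold qbin; rw [if_neg]; omega

lemma Bf_mem (n k r : ℕ) : Bf n k r ∈ natHom.rangeS := by
  unfold Bf
  split_ifs
  · exact gb_mem _ _
  · exact zero_mem _

lemma Bf_step (n k s : ℕ) (hkn : k ≤ n) :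
    qint k * Bf n k s = qint (s + 1) * Bf n k s + q ^ (s + 1) * qint (n - s - 1) * Bf n k (s + 1) := by
  unfold Bf
  rcases Nat.lt_or_ge (s + 1) k with h | h
  · rw [if_pos (by omega), if_pos h]
    obtain ⟨c, rfl⟩ := Nat.exists_eq_add_of_le (show s + 2 ≤ k by omega)
    obtain ⟨d, rfl⟩ := Nat.exists_eq_add_of_le hkn
    have e1 : s + 2 + c + d - s - 1 = c + d + 1 := by omega
    have e2 : s + 2 + c - s - 1 = c + 1 := by omega
    have e3 : s + 2 + c + d - (s + 1) - 1 = c + d := by omega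
    have e4 : s + 2 + c - (s + 1) - 1 = c := by omega
    have e5 : s + 2 + c = (s + 1) + (c + 1) := by omega
    rw [e1, e2, e3, e4, e5, qint_add]
    linear_combination q ^ (s + 1) * gb_absorb (c + d) c
  · rw [if_neg (show ¬ s + 1 < k by omega)]
    split_ifs with h2
    · have : k = s + 1 := by omega
      rw [this]; simp
    · simp

lemma coeff_step (p m s : ℕ) :
    qint (s + 1) * (gb (p + 1) (s + 1) * gb (m + 1) (s + 1)) =
      q ^ (s + 1) * qint (s + 1) * (gb p (s + 1) * gb m (s + 1)) +
        qint (p + m + 2 - s - 1) * (gb p s * gb m s) := by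
  rcases Nat.lt_or_ge p s with h | h
  · rw [gb_lt p s h, gb_lt (p + 1) (s + 1) (by omega), gb_lt p (s + 1) (by omega)]; simp
  rcases Nat.lt_or_ge m s with h' | h'
  · rw [gb_lt m s h', gb_lt (m + 1) (s + 1) (by omega), gb_lt m (s + 1) (by omega)]; simp
  obtain ⟨a, rfl⟩ := Nat.exists_eq_add_of_le h
  obtain ⟨b, rfl⟩ := Nat.exists_eq_add_of_le h'
  have e : s + a + (s + b) + 2 - s - 1 = s + 1 + a + b := by omega
  rw [e]
  have h1 := gb_absorb (s + a) s
  have h2 := gb_absorb (s + b) s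
  have h3 := gb_step s a
  have h4 := gb_step s b
  have key : qint (s + a + 1) * qint (s + b + 1) =
      q ^ (s + 1) * (qint a * qint b) + qint (s + 1) * qint (s + 1 + a + b) := by
    have := one_sub_q_ne
    unfold qint
    field_simp
    ring
  apply mul_left_cancel₀ (qint_succ_ne s)
  calc _ = (qint (s + 1) * gb (s + a + 1) (s + 1)) * (qint (s + 1) * gb (s + b + 1) (s + 1)) := by
        ring
    _ = (qint (s + a + 1) * qint (s + b + 1)) * (gb (s + a) s * gb (s + b) s) := by
        rw [h1, h2]; ring
    _ = q ^ (s + 1) * ((qint a * gb (s + a) s) * (qint b * gb (s + b) s)) +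
        qint (s + 1) * (qint (s + 1 + a + b) * (gb (s + a) s * gb (s + b) s)) := by
        rw [key]; ring
    _ = _ := by rw [← h3, ← h4]; ring

lemma main_identity (p m k : ℕ) (hk : k ≤ p + m + 2) :
    ∑ r ∈ Finset.range (p + m + 2 + 1),
        gb (p + 1) r * gb (m + 1) r * Bf (p + m + 2) k r * q ^ (r ^ 2) =
      qint k * ∑ s ∈ Finset.range (p + m + 2),
        q ^ (s ^ 2 + s) / qint (s + 1) * (gb p s * gb m s) * Bf (p + m + 2) k s := by
  rw [Finset.mul_sum]
  have hR : ∀ s, qint k * (q ^ (s ^ 2 + s) / qint (s + 1) * (gb p s * gb m s) * Bf (p + m + 2) k s)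
      = q ^ (s ^ 2 + s) * (gb p s * gb m s) * Bf (p + m + 2) k s +
        q ^ ((s + 1) ^ 2) / qint (s + 1) * (qint (p + m + 2 - s - 1) * (gb p s * gb m s)) *
          Bf (p + m + 2) k (s + 1) := by
    intro s
    have hs := qint_succ_ne s
    have := Bf_step (p + m + 2) k s hk
    calc _ = q ^ (s ^ 2 + s) / qint (s + 1) * (gb p s * gb m s) *
          (qint k * Bf (p + m + 2) k s) := by ring
      _ = _ := by
        rw [this]
        field_simp
        ring
  rw [Finset.sum_congr rfl fun s _ => hR s, Finset.sum_add_distrib]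
  have hU : ∑ s ∈ Finset.range (p + m + 2), q ^ (s ^ 2 + s) * (gb p s * gb m s) * Bf (p + m + 2) k s
      = ∑ s ∈ Finset.range (p + m + 2),
          q ^ ((s + 1) ^ 2 + (s + 1)) * (gb p (s + 1) * gb m (s + 1)) * Bf (p + m + 2) k (s + 1)
        + Bf (p + m + 2) k 0 := by
    have h1 := Finset.sum_range_succ'
      (fun s => q ^ (s ^ 2 + s) * (gb p s * gb m s) * Bf (p + m + 2) k s) (p + m + 2)
    rw [Finset.sum_range_succ, gb_lt p (p + m + 2) (by omega)] at h1
    simpa [gb_zero_right] using h1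
  rw [hU, add_right_comm _ (Bf (p + m + 2) k 0), ← Finset.sum_add_distrib, Finset.sum_range_succ']
  congr 1
  · apply Finset.sum_congr rfl
    intro s _
    have hs := qint_succ_ne s
    have h := coeff_step p m s
    have h' : gb (p + 1) (s + 1) * gb (m + 1) (s + 1) =
      q ^ (s + 1) * (gb p (s + 1) * gb m (s + 1)) +
        qint (p + m + 2 - s - 1) * (gb p s * gb m s) / qint (s + 1) := by
      field_simp
      linear_combination h
    rw [h']
    ring
  · simp [gb_zero_right]

lemma gbin2_eq (p m k : ℕ) (hk : k ≤ p + m) :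
    gbin2 (p + m) p k = qint (p + m) / qint k * ∑ r ∈ Finset.range (p + m + 1),
        gb p r * gb m r * Bf (p + m) k r * q ^ (r ^ 2) := by
  unfold gbin2
  congr 1
  apply Finset.sum_congr rfl
  intro r _
  rw [Bf_eq _ _ _ hk, qbin_eq]
  have : ((p + m : ℕ) : ℤ) - p = (m : ℕ) := by push_cast; ring
  rw [this, qbin_eq]

lemma gbin2_mem (p m k : ℕ) (hp : 0 < p) (hk : 0 < k) : gbin2 (p + m) p k ∈ natHom.rangeS := by
  rcases Nat.lt_or_ge (p + m) k with h | h
  · have : gbin2 (p + m) p k = 0 := by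
      unfold gbin2
      rw [Finset.sum_eq_zero, mul_zero]
      intro r _
      have : qbin (((p + m : ℕ) : ℤ) - r - 1) ((k : ℤ) - r - 1) = 0 := by
        unfold qbin; rw [if_neg]; omega
      rw [this]; simp
    rw [this]; exact zero_mem _
  rw [gbin2_eq p m k h]
  obtain ⟨k, rfl⟩ := Nat.exists_eq_add_of_le' hk
  obtain ⟨p, rfl⟩ := Nat.exists_eq_add_of_le' hp
  have hk0 := qint_succ_ne k
  rcases m with _ | m
  · rw [Finset.sum_eq_single 0]
    · have h1 := gb_absorb p k
      have : qint (p + 1 + 0) / qint (k + 1) *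
          (gb (p + 1) 0 * gb 0 0 * Bf (p + 1 + 0) (k + 1) 0 * q ^ (0 ^ 2)) =
          gb (p + 1) (k + 1) := by
        simp only [gb_zero_right, Bf]
        simp
        field_simp
        linear_combination -h1
      rw [this]; exact gb_mem _ _
    · intro r _ hr
      rw [gb_lt 0 r (by omega)]; simp
    · simp
  · have e : p + 1 + (m + 1) = p + m + 2 := by omega
    rw [e] at h ⊢
    rw [main_identity p m (k + 1) h, ← mul_assoc, div_mul_cancel₀ _ hk0, Finset.mul_sum]
    apply sum_mem
    intro s _
    have hs := qint_succ_ne s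
    have h1 := gb_absorb p s
    have h2 := gb_absorb m s
    have h3 : qint (p + m + 2) = qint (p + 1) + q ^ (p + 1) * qint (m + 1) := by
      rw [← qint_add]; congr 1; omega
    have h4 : qint (p + m + 2) * (gb p s * gb m s) / qint (s + 1) =
        gb (p + 1) (s + 1) * gb m s + q ^ (p + 1) * (gb p s * gb (m + 1) (s + 1)) := by
      rw [h3]
      field_simp
      linear_combination -(gb m s) * h1 - q ^ (p + 1) * gb p s * h2
    have h5 : qint (p + m + 2) * (q ^ (s ^ 2 + s) / qint (s + 1) * (gb p s * gb m s) *
        Bf (p + m + 2) (k + 1) s) = q ^ (s ^ 2 + s) *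
        (qint (p + m + 2) * (gb p s * gb m s) / qint (s + 1)) * Bf (p + m + 2) (k + 1) s := by
      ring
    rw [h5, h4]
    exact mul_mem (mul_mem (pow_mem q_mem _) (add_mem (mul_mem (gb_mem _ _) (gb_mem _ _))
      (mul_mem (pow_mem q_mem _) (mul_mem (gb_mem _ _) (gb_mem _ _))))) (Bf_mem _ _ _)

lemma gbin2_top (p m : ℕ) (hp : 0 < p) : gbin2 (p + m) p (p + m) = gb (p + m) p := by
  rw [gbin2_eq p m _ le_rfl]
  obtain ⟨p, rfl⟩ := Nat.exists_eq_add_of_le' hp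
  have hne : qint (p + 1 + m) ≠ 0 := by
    have : p + 1 + m = p + m + 1 := by omega
    rw [this]; exact qint_succ_ne _
  rw [div_self hne, one_mul]
  have hv := vandermonde (p + 1) m 0
  rw [add_zero] at hv
  rw [← hv]
  symm
  apply Finset.sum_subset_zero_on_sdiff
  · intro x hx; simp at hx ⊢; omega
  · intro x hx
    simp at hx
    rw [gb_lt (p + 1) x (by omega)]; simp
  · intro r hr
    simp at hr
    simp only [add_zero]
    rcases Nat.lt_or_ge m r with h | h
    · rw [gb_lt m r h]; simp
    · by_cases h2 : r < p + 1 + m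
      · rw [Bf, if_pos h2, gb_self, mul_one, sq]
      · have hm : m = 0 := by omega
        have : r = 0 := by omega
        omega

theorem gbin2_properties (n p k : ℕ) (hn : 0 < n) (hp : 0 < p) (hk : 0 < k) (hpn : p ≤ n) :
    (∃ P : Polynomial ℕ,
        gbin2 n p k =
          algebraMap (Polynomial ℚ) (RatFunc ℚ) (P.map (Nat.castRingHom ℚ))) ∧
      gbin2 n p k = gbin2 n (n - p) k ∧ gbin2 n p n = qbin n p := by
  obtain ⟨m, rfl⟩ := Nat.exists_eq_add_of_le hpn
  refine ⟨?_, ?_, ?_⟩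
  · obtain ⟨P, hP⟩ := gbin2_mem p m k hp hk
    exact ⟨P, hP.symm⟩
  · unfold gbin2
    congr 1
    apply Finset.sum_congr rfl
    intro r _
    have e1 : ((p + m : ℕ) : ℤ) - p = (m : ℕ) := by push_cast; ring
    have e2 : ((p + m : ℕ) : ℤ) - (p + m - p : ℕ) = (p : ℕ) := by
      rw [Nat.add_sub_cancel_left]; push_cast; ring
    rw [e1, e2, Nat.add_sub_cancel_left, mul_comm (qbin p r)]
  · rw [gbin2_top p m hp, qbin_eq]
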